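/- Let E be a finite-dimensional real inner product space, ℏ > 0 a real number, V : ℝ × E → ℝ a smooth time-dependent potential, and X : ℝ × E → E a smooth time-dependent vector field. Let ρ : ℝ × E → ℝ and φ : ℝ × E → ℝ be smooth functions with ρ(t,x) > 0 for all (t,x), satisfying for all (t,x): (i) ∂φ/∂t(t,x) = (1/2)·‖∇φ(t,·)(x) + X(t,x)‖² + V(t,x) − (ℏ²/2)·Δ(√(ρ(t,·)))(x)/√(ρ(t,x)) and (ii) ∂ρ/∂t(t,x) = div(ρ(t,·)·(∇φ(t,·) + X(t,·)))(x). Then the function ψ(t,x) := √(ρ(t,x))·exp(−(i/ℏ)·φ(t,x)) satisfies the Schrödinger equation for a charged particle in an electromagnetic field: iℏ·∂ψ/∂t(t,x) = −(ℏ²/2)·Δψ(t,·)(x) + iℏ·Dψ(t,·)(x)(X(t,x)) + (1/2)·(iℏ·div X(t,·)(x) + ‖X(t,x)‖²)·ψ(t,x) + V(t,x)·ψ(t,x), where Dψ(t,·)(x)(X(t,x)) denotes the derivative of ψ(t,·) at x in the direction X(t,x). -/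

import Mathlib

open scoped BigOperators RealInnerProductSpace

/-- The Laplacian of a function on a finite-dimensional real inner product space,
defined as the trace of the second Fréchet derivative, computed via an orthonormal basis. -/
noncomputable def laplacian {E : Type*} [NormedAddCommGroup E] [InnerProductSpace ℝ E]
    [FiniteDimensional ℝ E] {F : Type*} [NormedAddCommGroup F] [NormedSpace ℝ F]
    (f : E → F) (x : E) : F :=
  ∑ i, fderiv ℝ (fun y => fderiv ℝ f y (stdOrthonormalBasis ℝ E i)) x (stdOrthonormalBasis ℝ E i)

/-- The divergence of a vector field, defined as the trace of its Fréchet derivative. -/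
noncomputable def vdiv {E : Type*} [NormedAddCommGroup E] [InnerProductSpace ℝ E]
    [FiniteDimensional ℝ E] (X : E → E) (x : E) : ℝ :=
  LinearMap.trace ℝ E (fderiv ℝ X x : E →ₗ[ℝ] E)

section Calculus

variable {E : Type*} [NormedAddCommGroup E] [InnerProductSpace ℝ E]

lemma fderiv_mul_cexp_apply {w : E → ℂ} {f : E → ℝ} {x : E} (c : ℂ)
    (hw : DifferentiableAt ℝ w x) (hf : DifferentiableAt ℝ f x) (v : E) :
    fderiv ℝ (fun y => w y * Complex.exp (c * (f y : ℂ))) x v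
      = (fderiv ℝ w x v + c * w x * (fderiv ℝ f x v : ℂ)) * Complex.exp (c * (f x : ℂ)) := by
  have h1 : HasFDerivAt (fun y => (f y : ℂ)) (Complex.ofRealCLM.comp (fderiv ℝ f x)) x :=
    Complex.ofRealCLM.hasFDerivAt.comp x hf.hasFDerivAt
  have h := hw.hasFDerivAt.mul (h1.const_mul c).cexp
  rw [show (fun y => w y * Complex.exp (c * (f y : ℂ)))
    = w * fun y => Complex.exp (c * (f y : ℂ)) from rfl, h.fderiv]
  simp
  ring

lemma fderiv_ofReal_apply {f : E → ℝ} {x : E} (hf : DifferentiableAt ℝ f x) (v : E) :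
    fderiv ℝ (fun y => (f y : ℂ)) x v = (fderiv ℝ f x v : ℂ) := by
  have h1 : HasFDerivAt (fun y => (f y : ℂ)) (Complex.ofRealCLM.comp (fderiv ℝ f x)) x :=
    Complex.ofRealCLM.hasFDerivAt.comp x hf.hasFDerivAt
  rw [h1.fderiv]
  simp

lemma ContDiff.differentiable_fderiv_apply {F : Type*} [NormedAddCommGroup F] [NormedSpace ℝ F]
    {f : E → F} (hf : ContDiff ℝ 2 f) (v : E) : Differentiable ℝ (fun y => fderiv ℝ f y v) :=
  ((hf.fderiv_right (m := 1) (by norm_num)).clm_apply contDiff_const).differentiable (by norm_num)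

lemma fderiv_fderiv_mul_cexp_apply {r f : E → ℝ} (hr : ContDiff ℝ 2 r) (hf : ContDiff ℝ 2 f)
    (c : ℂ) (x v : E) :
    fderiv ℝ (fun y => fderiv ℝ (fun z => (r z : ℂ) * Complex.exp (c * (f z : ℂ))) y v) x v
      = ((fderiv ℝ (fun y => fderiv ℝ r y v) x v : ℂ)
          + 2 * c * ((fderiv ℝ r x v * fderiv ℝ f x v : ℝ) : ℂ)
          + c * (r x : ℂ) * (fderiv ℝ (fun y => fderiv ℝ f y v) x v : ℂ)
          + c ^ 2 * (r x : ℂ) * ((fderiv ℝ f x v * fderiv ℝ f x v : ℝ) : ℂ))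
        * Complex.exp (c * (f x : ℂ)) := by
  have dr : Differentiable ℝ r := hr.differentiable (by norm_num)
  have df : Differentiable ℝ f := hf.differentiable (by norm_num)
  have ddr := hr.differentiable_fderiv_apply v
  have ddf := hf.differentiable_fderiv_apply v
  have toC : ∀ {g : E → ℝ}, Differentiable ℝ g → Differentiable ℝ (fun y => (g y : ℂ)) :=
    fun hg => Complex.ofRealCLM.differentiable.comp hg
  have h1 : (fun y => fderiv ℝ (fun z => (r z : ℂ) * Complex.exp (c * (f z : ℂ))) y v)
      = fun y => ((fderiv ℝ r y v : ℂ) + c * (r y : ℂ) * (fderiv ℝ f y v : ℂ))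
        * Complex.exp (c * (f y : ℂ)) := by
    funext y
    rw [fderiv_mul_cexp_apply c (toC dr y) (df y), fderiv_ofReal_apply (dr y)]
  have h2 : fderiv ℝ (fun y => (fderiv ℝ r y v : ℂ) + c * (r y : ℂ) * (fderiv ℝ f y v : ℂ)) x v
      = (fderiv ℝ (fun y => fderiv ℝ r y v) x v : ℂ)
        + c * ((fderiv ℝ r x v : ℂ) * (fderiv ℝ f x v : ℂ)
          + (r x : ℂ) * (fderiv ℝ (fun y => fderiv ℝ f y v) x v : ℂ)) := by
    have h := (toC ddr x).hasFDerivAt.add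
      (((toC dr x).hasFDerivAt.const_mul c).mul (toC ddf x).hasFDerivAt)
    have h' := congrArg (fun L : E →L[ℝ] ℂ => L v) h.fderiv
    refine Eq.trans h' ?_
    simp [fderiv_ofReal_apply (dr x), fderiv_ofReal_apply (ddr x), fderiv_ofReal_apply (ddf x)]
    ring
  have hw : Differentiable ℝ
      (fun y => (fderiv ℝ r y v : ℂ) + c * (r y : ℂ) * (fderiv ℝ f y v : ℂ)) :=
    (toC ddr).add (((toC dr).const_mul c).mul (toC ddf))
  rw [h1, fderiv_mul_cexp_apply c (hw x) (df x), h2]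
  push_cast
  ring

variable [FiniteDimensional ℝ E]

lemma sum_fderiv_mul_fderiv (g f : E → ℝ) (x : E) :
    ∑ i, fderiv ℝ g x (stdOrthonormalBasis ℝ E i) * fderiv ℝ f x (stdOrthonormalBasis ℝ E i)
      = fderiv ℝ g x (gradient f x) := by
  conv_rhs => rw [← (stdOrthonormalBasis ℝ E).sum_repr' (gradient f x)]
  rw [map_sum]
  refine Finset.sum_congr rfl fun i _ => ?_
  rw [map_smul, smul_eq_mul, inner_gradient_right]
  simp [mul_comm]

lemma fderiv_apply_gradient_self (f : E → ℝ) (x : E) :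
    fderiv ℝ f x (gradient f x) = ‖gradient f x‖ ^ 2 := by
  rw [← inner_gradient_left, real_inner_self_eq_norm_sq]

lemma laplacian_mul_cexp {r f : E → ℝ} (hr : ContDiff ℝ 2 r) (hf : ContDiff ℝ 2 f)
    (c : ℂ) (x : E) :
    laplacian (fun z => (r z : ℂ) * Complex.exp (c * (f z : ℂ))) x
      = (((laplacian r x : ℝ) : ℂ) + 2 * c * (fderiv ℝ r x (gradient f x) : ℂ)
          + c * (r x : ℂ) * ((laplacian f x : ℝ) : ℂ)
          + c ^ 2 * (r x : ℂ) * (‖gradient f x‖ : ℂ) ^ 2) * Complex.exp (c * (f x : ℂ)) := by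
  rw [← Complex.ofReal_pow, ← fderiv_apply_gradient_self, ← sum_fderiv_mul_fderiv,
    ← sum_fderiv_mul_fderiv]
  simp only [laplacian, fderiv_fderiv_mul_cexp_apply hr hf]
  rw [← Finset.sum_mul]
  simp only [Finset.sum_add_distrib, Complex.ofReal_sum, Finset.mul_sum]

lemma vdiv_eq_sum_inner (Y : E → E) (x : E) :
    vdiv Y x = ∑ i, ⟪stdOrthonormalBasis ℝ E i, fderiv ℝ Y x (stdOrthonormalBasis ℝ E i)⟫ := by
  rw [vdiv, LinearMap.trace_eq_sum_inner _ (stdOrthonormalBasis ℝ E)]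
  rfl

lemma vdiv_add {Y Z : E → E} {x : E} (hY : DifferentiableAt ℝ Y x) (hZ : DifferentiableAt ℝ Z x) :
    vdiv (fun y => Y y + Z y) x = vdiv Y x + vdiv Z x := by
  rw [vdiv, fderiv_fun_add hY hZ, ContinuousLinearMap.toLinearMap_add, map_add]
  rfl

lemma vdiv_smul {h : E → ℝ} {Y : E → E} {x : E} (hh : DifferentiableAt ℝ h x)
    (hY : DifferentiableAt ℝ Y x) :
    vdiv (fun y => h y • Y y) x = fderiv ℝ h x (Y x) + h x * vdiv Y x := by
  have hsum : fderiv ℝ h x (Y x) = ∑ i, fderiv ℝ h x (stdOrthonormalBasis ℝ E i)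
      * ⟪stdOrthonormalBasis ℝ E i, Y x⟫ := by
    conv_lhs => rw [← (stdOrthonormalBasis ℝ E).sum_repr' (Y x)]
    simp [map_sum, mul_comm]
  rw [vdiv_eq_sum_inner, vdiv_eq_sum_inner, fderiv_fun_smul hh hY, hsum, Finset.mul_sum,
    ← Finset.sum_add_distrib]
  refine Finset.sum_congr rfl fun i _ => ?_
  simp [inner_add_right, inner_smul_right, add_comm]

lemma ContDiff.differentiable_gradient {f : E → ℝ} (hf : ContDiff ℝ 2 f) :
    Differentiable ℝ (gradient f) :=
  (InnerProductSpace.toDual ℝ E).symm.toContinuousLinearEquiv.differentiable.comp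
    ((hf.fderiv_right (m := 1) (by norm_num)).differentiable (by norm_num))

lemma vdiv_gradient {f : E → ℝ} (hf : ContDiff ℝ 2 f) (x : E) :
    vdiv (gradient f) x = laplacian f x := by
  rw [vdiv_eq_sum_inner, laplacian]
  refine Finset.sum_congr rfl fun i _ => ?_
  have h : (fun y => fderiv ℝ f y (stdOrthonormalBasis ℝ E i))
      = fun y => ⟪stdOrthonormalBasis ℝ E i, gradient f y⟫ := by
    funext y
    rw [inner_gradient_right]
    simp
  rw [h, fderiv_inner_apply ℝ (differentiableAt_const _) (hf.differentiable_gradient x)]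
  simp

end Calculus

theorem hydrodynamical_to_schrodinger_electromagnetic {E : Type*} [NormedAddCommGroup E]
    [InnerProductSpace ℝ E] [FiniteDimensional ℝ E]
    (ℏ : ℝ) (hℏ : 0 < ℏ)
    (V : ℝ → E → ℝ) (hV : ContDiff ℝ (⊤ : ℕ∞) (Function.uncurry V))
    (X : ℝ → E → E) (hX : ContDiff ℝ (⊤ : ℕ∞) (Function.uncurry X))
    (ρ φ : ℝ → E → ℝ)
    (hρ : ContDiff ℝ (⊤ : ℕ∞) (Function.uncurry ρ)) (hφ : ContDiff ℝ (⊤ : ℕ∞) (Function.uncurry φ))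
    (hpos : ∀ t x, 0 < ρ t x)
    (heq1 : ∀ t x, deriv (fun s => φ s x) t
      = (1 / 2) * ‖gradient (φ t) x + X t x‖ ^ 2 + V t x
        - (ℏ ^ 2 / 2) * laplacian (fun y => Real.sqrt (ρ t y)) x / Real.sqrt (ρ t x))
    (heq2 : ∀ t x, deriv (fun s => ρ s x) t
      = vdiv (fun y => ρ t y • (gradient (φ t) y + X t y)) x)
    (ψ : ℝ → E → ℂ)
    (hψ : ∀ t x, ψ t x
      = (Real.sqrt (ρ t x) : ℂ) * Complex.exp (-(Complex.I / ℏ) * (φ t x : ℂ))) :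
    ∀ t x, Complex.I * (ℏ : ℂ) * deriv (fun s => ψ s x) t
      = -((ℏ : ℂ) ^ 2 / 2) * laplacian (ψ t) x
        + Complex.I * (ℏ : ℂ) * fderiv ℝ (ψ t) x (X t x)
        + (1 / 2) * (Complex.I * (ℏ : ℂ) * (vdiv (X t) x : ℂ) + (‖X t x‖ : ℂ) ^ 2) * ψ t x
        + (V t x : ℂ) * ψ t x := by
  intro t x
  have slice : ∀ {g : ℝ → E → ℝ}, ContDiff ℝ (⊤ : ℕ∞) (Function.uncurry g) →
        ContDiff ℝ 2 (g t) ∧ DifferentiableAt ℝ (fun s => g s x) t := by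
    intro g hg
    have h2 : ContDiff ℝ 2 (Function.uncurry g) := contDiff_infty.1 hg 2
    exact ⟨h2.comp (contDiff_const.prodMk contDiff_id),
      (h2.comp (contDiff_id.prodMk contDiff_const)).differentiable (by norm_num) t⟩
  obtain ⟨cρ, dρ⟩ := slice hρ
  obtain ⟨cφ, dφ⟩ := slice hφ
  have dX : DifferentiableAt ℝ (X t) x := by
    have h2 : ContDiff ℝ 2 (Function.uncurry X) := contDiff_infty.1 hX 2
    exact (h2.comp (contDiff_const.prodMk contDiff_id)).differentiable (by norm_num) x
  set r : E → ℝ := fun y => Real.sqrt (ρ t y)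
  have cr : ContDiff ℝ 2 r := cρ.sqrt fun y => (hpos t y).ne'
  have hr0 : 0 < r x := Real.sqrt_pos.2 (hpos t x)
  have hρr : ∀ y, ρ t y = r y * r y := fun y => (Real.mul_self_sqrt (hpos t y).le).symm
  have dr : Differentiable ℝ r := cr.differentiable (by norm_num)
  have hDρ : ∀ v, fderiv ℝ (ρ t) x v = 2 * r x * fderiv ℝ r x v := by
    intro v
    rw [show ρ t = fun y => r y * r y from funext hρr, fderiv_fun_mul (dr x) (dr x)]
    simp
    ring
  -- the time derivative of the amplitude
  have hrt : HasDerivAt (fun s => Real.sqrt (ρ s x))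
      (deriv (fun s => ρ s x) t / (2 * r x)) t := dρ.hasDerivAt.sqrt (hpos t x).ne'
  set c : ℂ := -(Complex.I / ℏ) with hc
  have hψt : ψ t = fun y => (r y : ℂ) * Complex.exp (c * (φ t y : ℂ)) := funext fun y => hψ t y
  have hψ' : HasDerivAt (fun s => ψ s x)
      (((deriv (fun s => ρ s x) t / (2 * r x) : ℝ) : ℂ) * Complex.exp (c * (φ t x : ℂ))
        + (r x : ℂ) * (Complex.exp (c * (φ t x : ℂ))
          * (c * ((deriv (fun s => φ s x) t : ℝ) : ℂ)))) t := by
    rw [show (fun s => ψ s x) = fun s => ((Real.sqrt (ρ s x) : ℝ) : ℂ)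
      * Complex.exp (c * (φ s x : ℂ)) from funext fun s => hψ s x]
    exact hrt.ofReal_comp.mul (dφ.hasDerivAt.ofReal_comp.const_mul c).cexp
  have dcr : DifferentiableAt ℝ (fun y => (r y : ℂ)) x :=
    Complex.ofRealCLM.differentiableAt.comp x (dr x)
  have df : DifferentiableAt ℝ (φ t) x := cφ.differentiable (by norm_num) x
  have dg := cφ.differentiable_gradient x
  have hρt : deriv (fun s => ρ s x) t / (2 * r x)
      = fderiv ℝ r x (gradient (φ t) x) + fderiv ℝ r x (X t x)
        + r x / 2 * (laplacian (φ t) x + vdiv (X t) x) := by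
    rw [heq2, vdiv_smul (cρ.differentiable (by norm_num) x) (Y := fun y => gradient (φ t) y + X t y) (dg.add dX),
      vdiv_add dg dX,
      vdiv_gradient cφ, hDρ, map_add, hρr]
    field_simp
  have hφt : r x * deriv (fun s => φ s x) t
      = r x / 2 * (‖gradient (φ t) x‖ ^ 2 + 2 * fderiv ℝ (φ t) x (X t x) + ‖X t x‖ ^ 2)
        + r x * V t x - ℏ ^ 2 / 2 * laplacian r x := by
    rw [heq1, norm_add_sq_real, inner_gradient_left]
    change r x * (_ - ℏ ^ 2 / 2 * laplacian r x / r x) = _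
    field_simp
  have hℏ' : (ℏ : ℂ) ≠ 0 := by exact_mod_cast hℏ.ne'
  have hcℏ : (ℏ : ℂ) * c = -Complex.I := by rw [hc]; field_simp
  have hφtC := congrArg (fun a : ℝ => (a : ℂ)) hφt
  push_cast at hφtC
  rw [hψ'.deriv, hρt, hψt, laplacian_mul_cexp cr cφ, fderiv_mul_cexp_apply c dcr df,
    fderiv_ofReal_apply (dr x)]
  push_cast
  set e := Complex.exp (c * (φ t x : ℂ))
  have hI := Complex.I_mul_I
  linear_combination e * hφtC + (Complex.I * r x * (deriv (fun s => φ s x) t : ℝ) * e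
      + (ℏ : ℂ) / 2 * (2 * (fderiv ℝ r x (gradient (φ t) x) : ℝ)
        + r x * (laplacian (φ t) x : ℝ)) * e
      + r x * (‖gradient (φ t) x‖ : ℂ) ^ 2 / 2 * e * (ℏ * c - Complex.I)
      - Complex.I * r x * (fderiv ℝ (φ t) x (X t x) : ℝ) * e) * hcℏ
    + (- (r x * (deriv (fun s => φ s x) t : ℝ) * e)
      + r x * (‖gradient (φ t) x‖ : ℂ) ^ 2 / 2 * e
      + r x * (fderiv ℝ (φ t) x (X t x) : ℝ) * e) * hI
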